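/- arXiv:math/0703408 — 2 statements merged into one kernel-verified Lean document; each statement's English description precedes it below -/
import Mathlib

section
/- For all Borel probability measures μ and ν on ℝ there exists a unique Borel probability measure λ on ℝ such that G_λ(z) = G_μ(1/G_ν(z)) for all z ∈ ℂ⁺ (equivalently, F_λ = F_μ ∘ F_ν on ℂ⁺). The measure λ is the additive monotone convolution μ ▷ ν. -/
open MeasureTheory

/-- The Cauchy transform `G_ρ(z) = ∫ 1/(z−t) dρ(t)` of a measure on `ℝ`. -/
noncomputable def cauchyTransform (ρ : Measure ℝ) (z : ℂ) : ℂ := ∫ t, (z - (t : ℂ))⁻¹ ∂ρ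

open Filter Topology BoundedContinuousFunction Complex

namespace CauchyTransform

lemma sub_ofReal_ne_zero {z : ℂ} (hz : z.im ≠ 0) (t : ℝ) : z - (t : ℂ) ≠ 0 := by
  intro h
  apply hz
  simpa using congrArg Complex.im h

lemma norm_inv_sub_ofReal_le {z : ℂ} (hz : z.im ≠ 0) (t : ℝ) :
    ‖(z - (t : ℂ))⁻¹‖ ≤ |z.im|⁻¹ := by
  rw [norm_inv]
  apply inv_anti₀ (abs_pos.2 hz)
  simpa using Complex.abs_im_le_norm (z - (t : ℂ))

lemma continuous_inv_sub_ofReal {z : ℂ} (hz : z.im ≠ 0) :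
    Continuous fun t : ℝ => (z - (t : ℂ))⁻¹ :=
  (by fun_prop : Continuous fun t : ℝ => z - (t : ℂ)).inv₀ (sub_ofReal_ne_zero hz)

/-- The resolvent function `t ↦ (z - t)⁻¹` as a bounded continuous function on `ℝ`. -/
noncomputable def resolventBCF (z : {z : ℂ // z.im ≠ 0}) : ℝ →ᵇ ℂ :=
  BoundedContinuousFunction.ofNormedAddCommGroup (fun t : ℝ => (z.1 - (t : ℂ))⁻¹)
    (continuous_inv_sub_ofReal z.2) |z.1.im|⁻¹ (norm_inv_sub_ofReal_le z.2)

@[simp]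
lemma resolventBCF_apply (z : {z : ℂ // z.im ≠ 0}) (t : ℝ) :
    resolventBCF z t = (z.1 - (t : ℂ))⁻¹ := rfl

lemma integrable_inv_sub_ofReal (ρ : Measure ℝ) [IsFiniteMeasure ρ] {z : ℂ} (hz : z.im ≠ 0) :
    Integrable (fun t : ℝ => (z - (t : ℂ))⁻¹) ρ :=
  (resolventBCF ⟨z, hz⟩).integrable ρ

lemma cauchyTransform_conj (ρ : Measure ℝ) (z : ℂ) :
    cauchyTransform ρ (starRingEnd ℂ z) = starRingEnd ℂ (cauchyTransform ρ z) := by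
  rw [cauchyTransform, cauchyTransform, ← integral_conj]
  simp

/-! ### Uniqueness -/

/-- The closed span of the constants and the resolvent functions. -/
noncomputable def resolventSpan : Submodule ℂ (ℝ →ᵇ ℂ) :=
  (Submodule.span ℂ (insert 1 (Set.range resolventBCF))).topologicalClosure

lemma one_mem_resolventSpan : (1 : ℝ →ᵇ ℂ) ∈ resolventSpan :=
  Submodule.le_topologicalClosure _ (Submodule.subset_span (by simp))

lemma resolventBCF_mem_resolventSpan (z : {z : ℂ // z.im ≠ 0}) :
    resolventBCF z ∈ resolventSpan :=
  Submodule.le_topologicalClosure _ (Submodule.subset_span (by simp))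

lemma resolventBCF_sub (z w : {z : ℂ // z.im ≠ 0}) :
    resolventBCF z - resolventBCF w = (w.1 - z.1) • (resolventBCF z * resolventBCF w) := by
  ext t
  have h1 := sub_ofReal_ne_zero z.2 t
  have h2 := sub_ofReal_ne_zero w.2 t
  simp
  field_simp
  ring

lemma resolventBCF_mul_mem_of_ne {z w : {z : ℂ // z.im ≠ 0}} (h : w.1 ≠ z.1) :
    resolventBCF z * resolventBCF w ∈ resolventSpan := by
  have h' : w.1 - z.1 ≠ 0 := sub_ne_zero.2 h
  have : resolventBCF z * resolventBCF w =
      (w.1 - z.1)⁻¹ • (resolventBCF z - resolventBCF w) := by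
    rw [resolventBCF_sub, smul_smul, inv_mul_cancel₀ h', one_smul]
  rw [this]
  exact resolventSpan.smul_mem _
    (resolventSpan.sub_mem (resolventBCF_mem_resolventSpan z) (resolventBCF_mem_resolventSpan w))

lemma continuous_resolventBCF : Continuous resolventBCF := by
  rw [continuous_iff_continuousAt]
  intro z
  rw [ContinuousAt, tendsto_iff_norm_sub_tendsto_zero]
  have hc : Tendsto (fun w : {z : ℂ // z.im ≠ 0} => ‖z.1 - w.1‖ * (|w.1.im|⁻¹ * |z.1.im|⁻¹))
      (𝓝 z) (𝓝 0) := by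
    have : ContinuousAt (fun w : {z : ℂ // z.im ≠ 0} =>
        ‖z.1 - w.1‖ * (|w.1.im|⁻¹ * |z.1.im|⁻¹)) z := by
      apply ContinuousAt.mul (by fun_prop)
      apply ContinuousAt.mul _ (by fun_prop)
      have : Continuous fun w : {z : ℂ // z.im ≠ 0} => |w.1.im| :=
        (Complex.continuous_im.comp continuous_subtype_val).abs
      exact this.continuousAt.inv₀ (abs_ne_zero.2 z.2)
    simpa [ContinuousAt] using this
  refine squeeze_zero (fun _ => norm_nonneg _) (fun w => ?_) hc
  rw [resolventBCF_sub, norm_smul]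
  gcongr
  refine (norm_mul_le _ _).trans ?_
  gcongr
  · exact norm_ofNormedAddCommGroup_le _ (by positivity) _
  · exact norm_ofNormedAddCommGroup_le _ (by positivity) _

lemma isClosed_resolventSpan : IsClosed (resolventSpan : Set (ℝ →ᵇ ℂ)) :=
  Submodule.isClosed_topologicalClosure _

lemma resolventBCF_mul_mem (z w : {z : ℂ // z.im ≠ 0}) :
    resolventBCF z * resolventBCF w ∈ resolventSpan := by
  by_cases h : w.1 = z.1
  · obtain rfl : w = z := Subtype.ext h
    let u : ℕ → {z : ℂ // z.im ≠ 0} := fun n => ⟨w.1 + ((1 / ((n : ℝ) + 1) : ℝ) : ℂ), by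
      simpa only [Complex.add_im, Complex.ofReal_im, add_zero] using w.2⟩
    have hu : Tendsto u atTop (𝓝 w) := by
      rw [tendsto_subtype_rng]
      have h0 : Tendsto (fun n : ℕ => ((1 / ((n : ℝ) + 1) : ℝ) : ℂ)) atTop (𝓝 ((0 : ℝ) : ℂ)) :=
        (Complex.continuous_ofReal.tendsto 0).comp tendsto_one_div_add_atTop_nhds_zero_nat
      simpa [u] using h0.const_add w.1
    refine isClosed_resolventSpan.mem_of_tendsto
      (((continuous_resolventBCF.tendsto w).comp hu).mul_const (resolventBCF w))
      (Eventually.of_forall fun n => resolventBCF_mul_mem_of_ne ?_)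
    intro h
    have : (n : ℝ) + 1 ≠ 0 := by positivity
    have h2 : ((1 / ((n : ℝ) + 1) : ℝ) : ℂ) = 0 := by simpa [u] using h
    rw [Complex.ofReal_eq_zero] at h2
    exact one_div_ne_zero this h2
  · exact resolventBCF_mul_mem_of_ne h

lemma resolventBCF_mul_mem_resolventSpan (z : {z : ℂ // z.im ≠ 0}) {g : ℝ →ᵇ ℂ}
    (hg : g ∈ resolventSpan) : resolventBCF z * g ∈ resolventSpan := by
  refine closure_minimal (t := {g | resolventBCF z * g ∈ resolventSpan}) ?_
    (isClosed_resolventSpan.preimage (continuous_const.mul continuous_id)) hg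
  intro g hg
  refine Submodule.span_induction (p := fun g _ => resolventBCF z * g ∈ resolventSpan)
    ?_ ?_ ?_ ?_ hg
  · rintro _ (rfl | ⟨w, rfl⟩)
    · simpa using resolventBCF_mem_resolventSpan z
    · exact resolventBCF_mul_mem z w
  · simp
  · intro x y _ _ hx hy
    rw [mul_add]
    exact resolventSpan.add_mem hx hy
  · intro c x _ hx
    rw [mul_smul_comm]
    exact resolventSpan.smul_mem _ hx

lemma integral_eq_of_mem_resolventSpan {ρ σ : Measure ℝ} [IsProbabilityMeasure ρ]
    [IsProbabilityMeasure σ]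
    (h : ∀ z : ℂ, 0 < z.im → cauchyTransform ρ z = cauchyTransform σ z)
    {g : ℝ →ᵇ ℂ} (hg : g ∈ resolventSpan) : ∫ t, g t ∂ρ = ∫ t, g t ∂σ := by
  have hc (τ : Measure ℝ) [IsProbabilityMeasure τ] :
      Continuous fun g : ℝ →ᵇ ℂ => ∫ t, g t ∂τ := by
    rw [continuous_iff_continuousAt]
    intro g
    rw [ContinuousAt, tendsto_iff_norm_sub_tendsto_zero]
    refine squeeze_zero (fun _ => norm_nonneg _) (fun f => ?_)
      (tendsto_iff_norm_sub_tendsto_zero.1 (tendsto_id (x := 𝓝 g)))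
    rw [← integral_sub (f.integrable τ) (g.integrable τ)]
    simpa using norm_integral_le_norm τ (f - g)
  refine closure_minimal (t := {g : ℝ →ᵇ ℂ | ∫ t, g t ∂ρ = ∫ t, g t ∂σ}) ?_
    (isClosed_eq (hc ρ) (hc σ)) hg
  intro g hg
  refine Submodule.span_induction (p := fun g _ => ∫ t, g t ∂ρ = ∫ t, g t ∂σ) ?_ ?_ ?_ ?_ hg
  · rintro _ (rfl | ⟨⟨w, hw⟩, rfl⟩)
    · simp
    · change cauchyTransform ρ w = cauchyTransform σ w
      rcases hw.lt_or_gt with hw | hw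
      · have := h (starRingEnd ℂ w) (by simpa using hw)
        rw [cauchyTransform_conj, cauchyTransform_conj] at this
        exact (starRingEnd ℂ).injective this
      · exact h w hw
  · simp
  · intro x y _ _ hx hy
    have e (τ : Measure ℝ) [IsProbabilityMeasure τ] :
        ∫ t, (x + y) t ∂τ = ∫ t, x t ∂τ + ∫ t, y t ∂τ :=
      integral_add (x.integrable τ) (y.integrable τ)
    rw [e, e, hx, hy]
  · intro c x _ hx
    have e (τ : Measure ℝ) [IsProbabilityMeasure τ] :
        ∫ t, (c • x) t ∂τ = c • ∫ t, x t ∂τ :=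
      integral_smul c _
    rw [e, e, hx]

lemma star_resolventBCF (z : {z : ℂ // z.im ≠ 0}) :
    star (resolventBCF z) = resolventBCF ⟨starRingEnd ℂ z.1, by simpa using z.2⟩ := by
  ext t
  simp

lemma adjoin_le_resolventSpan {g : ℝ →ᵇ ℂ}
    (hg : g ∈ StarAlgebra.adjoin ℂ (Set.range resolventBCF)) : g ∈ resolventSpan := by
  rw [← StarSubalgebra.mem_toSubalgebra, StarAlgebra.adjoin_toSubalgebra] at hg
  suffices ∀ f ∈ resolventSpan, g * f ∈ resolventSpan by
    simpa using this 1 one_mem_resolventSpan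
  refine Algebra.adjoin_induction (p := fun g _ => ∀ f ∈ resolventSpan, g * f ∈ resolventSpan)
    ?_ ?_ ?_ ?_ hg
  · rintro g (⟨z, rfl⟩ | ⟨z, hz⟩) f hf
    · exact resolventBCF_mul_mem_resolventSpan z hf
    · rw [← star_star g, ← hz, star_resolventBCF]
      exact resolventBCF_mul_mem_resolventSpan _ hf
  · intro r f hf
    rw [← Algebra.smul_def]
    exact resolventSpan.smul_mem _ hf
  · intro x y _ _ hx hy f hf
    rw [add_mul]
    exact resolventSpan.add_mem (hx f hf) (hy f hf)
  · intro x y _ _ hx hy f hf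
    rw [mul_assoc]
    exact hx _ (hy f hf)

/-- A probability measure on `ℝ` is determined by its Cauchy transform on the upper half-plane. -/
theorem ext_of_cauchyTransform {ρ σ : Measure ℝ} [IsProbabilityMeasure ρ]
    [IsProbabilityMeasure σ]
    (h : ∀ z : ℂ, 0 < z.im → cauchyTransform ρ z = cauchyTransform σ z) : ρ = σ := by
  refine ext_of_forall_mem_subalgebra_integral_eq_of_polish (𝕜 := ℂ)
    (A := StarAlgebra.adjoin ℂ (Set.range resolventBCF)) ?_
    fun g hg => integral_eq_of_mem_resolventSpan h (adjoin_le_resolventSpan hg)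
  intro s t hst
  have hI : (I : ℂ).im ≠ 0 := by simp
  refine ⟨resolventBCF ⟨I, hI⟩, ⟨toContinuousMapStarₐ ℂ (resolventBCF ⟨I, hI⟩),
    ⟨_, StarAlgebra.subset_adjoin ℂ _ ⟨_, rfl⟩, rfl⟩, rfl⟩, ?_⟩
  simpa using hst

/-! ### Finitely supported measures -/

/-- Rank-one perturbation of a diagonal matrix: the Cauchy transform `S` of the spectral
distribution of `diagonal a + x • v vᵀ` at `v` satisfies `g = (1 - x g) S`, where `g` is that of
`diagonal a`. -/
lemma exists_rank_one_perturbation {ι : Type*} [Fintype ι] (a v : ι → ℝ) (x : ℝ) :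
    ∃ α c : ι → ℝ, ∑ j, c j ^ 2 = ∑ i, v i ^ 2 ∧ ∀ z : ℂ, z.im ≠ 0 →
      ∑ i, (v i : ℂ) ^ 2 * (z - a i)⁻¹ =
        (1 - x * ∑ i, (v i : ℂ) ^ 2 * (z - a i)⁻¹) * ∑ j, (c j : ℂ) ^ 2 * (z - α j)⁻¹ := by
  classical
  let A : Matrix ι ι ℝ := Matrix.diagonal a + x • Matrix.vecMulVec v v
  have hA : A.IsHermitian := by
    ext i j
    rcases eq_or_ne i j with rfl | hij
    · simp
    · simp [A, Matrix.vecMulVec_apply, hij, hij.symm, mul_comm (v i)]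
  let e := hA.eigenvectorBasis
  let α := hA.eigenvalues
  let c : ι → ℝ := fun j => ∑ i, v i * e j i
  have hexp (i : ι) : ∑ j, c j * e j i = v i := by
    have h := e.sum_repr' (WithLp.toLp 2 v)
    have h2 := congrArg (fun w : EuclideanSpace ℝ ι => w i) h
    simpa [c, PiLp.inner_apply] using h2
  have heig (j i : ι) : a i * e j i + x * (v i * c j) = α j * e j i := by
    have h := congrFun (hA.mulVec_eigenvectorBasis j) i
    simp only [A, Matrix.add_mulVec, Matrix.smul_mulVec, Matrix.mulVec_diagonal,
      Matrix.vecMulVec_mulVec, Pi.add_apply, Pi.smul_apply, smul_eq_mul] at h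
    rw [← h]
    simp [c, dotProduct, e, mul_comm]
  refine ⟨α, c, ?_, fun z hz => ?_⟩
  · calc ∑ j, c j ^ 2 = ∑ j, ∑ i, c j * (v i * e j i) := by
          simp_rw [← Finset.mul_sum, sq]; rfl
      _ = ∑ i, ∑ j, c j * (v i * e j i) := Finset.sum_comm
      _ = ∑ i, v i ^ 2 := by
          refine Finset.sum_congr rfl fun i _ => ?_
          rw [sq, ← congrArg (v i * ·) (hexp i), Finset.mul_sum]
          exact Finset.sum_congr rfl fun j _ => by ring
  · set g : ℂ := ∑ i, (v i : ℂ) ^ 2 * (z - a i)⁻¹ with hg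
    have hj (j : ι) : ∑ i, (v i : ℂ) * e j i * (z - a i)⁻¹ =
        (1 - x * g) * (c j * (z - α j)⁻¹) := by
      have hα := sub_ofReal_ne_zero hz (α j)
      have key (i : ι) : (v i : ℂ) * e j i * (z - a i)⁻¹ =
          (v i * e j i : ℝ) * (z - α j)⁻¹ -
            x * (c j * (z - α j)⁻¹) * ((v i : ℂ) ^ 2 * (z - a i)⁻¹) := by
        have ha := sub_ofReal_ne_zero hz (a i)
        have h : (a i : ℂ) * e j i + x * (v i * c j) = α j * e j i := by
          exact_mod_cast congrArg Complex.ofReal (heig j i)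
        push_cast
        field_simp
        linear_combination (v i : ℂ) * h
      rw [Finset.sum_congr rfl fun i _ => key i, Finset.sum_sub_distrib, ← Finset.sum_mul,
        ← Finset.mul_sum, ← hg, ← Complex.ofReal_sum]
      change (c j : ℂ) * _ - _ = _
      ring
    calc g = ∑ i, ∑ j, (c j : ℂ) * ((v i : ℂ) * e j i * (z - a i)⁻¹) := by
          rw [hg]
          refine Finset.sum_congr rfl fun i _ => ?_
          have : (v i : ℂ) = ∑ j, (c j : ℂ) * e j i := by
            exact_mod_cast congrArg Complex.ofReal (hexp i).symm
          rw [sq]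
          nth_rewrite 2 [this]
          rw [Finset.mul_sum, Finset.sum_mul]
          exact Finset.sum_congr rfl fun j _ => by ring
      _ = ∑ j, (c j : ℂ) * ((1 - x * g) * (c j * (z - α j)⁻¹)) := by
          rw [Finset.sum_comm]
          exact Finset.sum_congr rfl fun j _ => by rw [← Finset.mul_sum, hj]
      _ = _ := by
          rw [Finset.mul_sum (s := Finset.univ) (f := fun j => (c j : ℂ) ^ 2 * (z - α j)⁻¹)]
          exact Finset.sum_congr rfl fun j _ => by ring

lemma exists_cauchyTransform_eq_sum {ι : Type*} (s : Finset ι) {w : ι → ℝ}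
    (hw : ∀ i ∈ s, 0 ≤ w i) (hsum : ∑ i ∈ s, w i = 1) (ρ : ι → Measure ℝ)
    [∀ i, IsProbabilityMeasure (ρ i)] :
    ∃ l : Measure ℝ, IsProbabilityMeasure l ∧ ∀ z : ℂ, z.im ≠ 0 →
      cauchyTransform l z = ∑ i ∈ s, (w i : ℂ) * cauchyTransform (ρ i) z := by
  refine ⟨∑ i ∈ s, ENNReal.ofReal (w i) • ρ i, ⟨?_⟩, fun z hz => ?_⟩
  · simp [← ENNReal.ofReal_sum_of_nonneg hw, hsum]
  · rw [cauchyTransform, integral_finsetSum_measure fun i _ =>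
      (integrable_inv_sub_ofReal (ρ i) hz).smul_measure ENNReal.ofReal_ne_top]
    refine Finset.sum_congr rfl fun i hi => ?_
    rw [integral_smul_measure, ENNReal.toReal_ofReal (hw i hi), real_smul, cauchyTransform]

lemma cauchyTransform_dirac (a : ℝ) (z : ℂ) :
    cauchyTransform (Measure.dirac a) z = (z - a)⁻¹ := by
  simp [cauchyTransform]

lemma cauchyTransform_im_neg (ρ : Measure ℝ) [IsProbabilityMeasure ρ] {z : ℂ}
    (hz : 0 < z.im) : (cauchyTransform ρ z).im < 0 := by
  have hi := integrable_inv_sub_ofReal ρ hz.ne'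
  have h1 : (cauchyTransform ρ z).im = ∫ t, ((z - (t : ℂ))⁻¹).im ∂ρ :=
    (Complex.imCLM.integral_comp_comm hi).symm
  have hneg (t : ℝ) : 0 < -((z - (t : ℂ))⁻¹).im := by
    rw [Complex.inv_im]
    have := Complex.normSq_pos.2 (sub_ofReal_ne_zero hz.ne' t)
    simp only [sub_im, ofReal_im, sub_zero, neg_div, neg_neg]
    positivity
  rw [h1, ← neg_pos, ← integral_neg,
    integral_pos_iff_support_of_nonneg (fun t => (hneg t).le) hi.im.neg]
  have : Function.support (fun t : ℝ => -((z - (t : ℂ))⁻¹).im) = Set.univ := by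
    ext t
    simpa using (neg_pos.1 (hneg t)).ne
  rw [this]
  simp

lemma cauchyTransform_ne_zero (ρ : Measure ℝ) [IsProbabilityMeasure ρ] {z : ℂ}
    (hz : 0 < z.im) : cauchyTransform ρ z ≠ 0 := by
  intro h
  simpa [h] using cauchyTransform_im_neg ρ hz

lemma inv_cauchyTransform_im_pos (ρ : Measure ℝ) [IsProbabilityMeasure ρ] {z : ℂ}
    (hz : 0 < z.im) : 0 < (cauchyTransform ρ z)⁻¹.im := by
  rw [Complex.inv_im]
  exact div_pos (neg_pos.2 (cauchyTransform_im_neg ρ hz))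
    (Complex.normSq_pos.2 (cauchyTransform_ne_zero ρ hz))

lemma integral_comp_simpleFunc (ρ : Measure ℝ) [IsFiniteMeasure ρ] (f : SimpleFunc ℝ ℝ)
    (h : ℝ → ℂ) : ∫ t, h (f t) ∂ρ = ∑ y ∈ f.range, (ρ.real (f ⁻¹' {y}) : ℂ) * h y := by
  have key (t : ℝ) : h (f t) = ∑ y ∈ f.range, (f ⁻¹' {y}).indicator (fun _ => h y) t := by
    rw [Finset.sum_eq_single (f t)]
    · simp
    · intro y _ hy
      simp [hy.symm]
    · intro ht
      exact absurd (f.mem_range_self t) ht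
  simp_rw [key]
  rw [integral_finsetSum _ fun y _ =>
    (integrable_const (h y)).indicator (f.measurableSet_fiber y)]
  refine Finset.sum_congr rfl fun y _ => ?_
  rw [integral_indicator_const _ (f.measurableSet_fiber y), real_smul]

lemma cauchyTransform_map_simpleFunc (ρ : Measure ℝ) [IsProbabilityMeasure ρ]
    (f : SimpleFunc ℝ ℝ) {z : ℂ} (hz : z.im ≠ 0) :
    cauchyTransform (ρ.map f) z = ∑ y ∈ f.range, (ρ.real (f ⁻¹' {y}) : ℂ) * (z - y)⁻¹ := by
  rw [cauchyTransform, integral_map f.measurable.aemeasurable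
    (continuous_inv_sub_ofReal hz).aestronglyMeasurable]
  exact integral_comp_simpleFunc ρ f fun y => (z - (y : ℂ))⁻¹

lemma sum_measureReal_preimage_singleton_range (ρ : Measure ℝ) [IsProbabilityMeasure ρ]
    (f : SimpleFunc ℝ ℝ) : ∑ y ∈ f.range, ρ.real (f ⁻¹' {y}) = 1 := by
  have h := integral_comp_simpleFunc ρ f fun _ => 1
  simp only [integral_const, probReal_univ, one_smul, mul_one] at h
  exact_mod_cast h.symm

lemma exists_cauchyTransform_eq_inv_sub (ν : Measure ℝ) [IsProbabilityMeasure ν]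
    (f : SimpleFunc ℝ ℝ) (x : ℝ) :
    ∃ l : Measure ℝ, IsProbabilityMeasure l ∧ ∀ z : ℂ, 0 < z.im →
      cauchyTransform l z = ((cauchyTransform (ν.map f) z)⁻¹ - x)⁻¹ := by
  have : IsProbabilityMeasure (ν.map f) :=
    Measure.isProbabilityMeasure_map f.measurable.aemeasurable
  obtain ⟨α, c, hc, h⟩ := exists_rank_one_perturbation (fun y : f.range => (y : ℝ))
    (fun y => √(ν.real (f ⁻¹' {(y : ℝ)}))) x
  have hsq (y : ℝ) : √(ν.real (f ⁻¹' {y})) ^ 2 = ν.real (f ⁻¹' {y}) :=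
    Real.sq_sqrt measureReal_nonneg
  have hsq' (y : ℝ) : (√(ν.real (f ⁻¹' {y})) : ℂ) ^ 2 = ν.real (f ⁻¹' {y}) := by
    exact_mod_cast congrArg Complex.ofReal (hsq y)
  simp only [hsq, hsq', Finset.sum_coe_sort f.range (fun y => ν.real (f ⁻¹' {y})),
    sum_measureReal_preimage_singleton_range] at hc h
  obtain ⟨l, hl, hlz⟩ := exists_cauchyTransform_eq_sum Finset.univ
    (fun j _ => sq_nonneg (c j)) hc (fun j => Measure.dirac (α j))
  refine ⟨l, hl, fun z hz => ?_⟩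
  have hg := cauchyTransform_ne_zero (ν.map f) hz
  have h' := h z hz.ne'
  rw [Finset.sum_coe_sort f.range (fun y => (ν.real (f ⁻¹' {y}) : ℂ) * (z - y)⁻¹),
    ← cauchyTransform_map_simpleFunc ν f hz.ne'] at h'
  have hlz' := hlz z hz.ne'
  simp only [cauchyTransform_dirac, ofReal_pow] at hlz'
  rw [← hlz'] at h'
  set g := cauchyTransform (ν.map f) z
  have h1 : 1 - x * g ≠ 0 := by
    intro h0
    rw [h0, zero_mul] at h'
    exact hg h'
  have h2 : g⁻¹ - x = (1 - x * g) / g := by field_simp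
  rw [h2, inv_div, eq_div_iff h1, mul_comm]
  exact h'.symm

lemma exists_cauchyTransform_comp_map_simpleFunc (μ ν : Measure ℝ) [IsProbabilityMeasure μ]
    [IsProbabilityMeasure ν] (f k : SimpleFunc ℝ ℝ) :
    ∃ l : Measure ℝ, IsProbabilityMeasure l ∧ ∀ z : ℂ, 0 < z.im →
      cauchyTransform l z = cauchyTransform (μ.map k) (cauchyTransform (ν.map f) z)⁻¹ := by
  have : IsProbabilityMeasure (ν.map f) :=
    Measure.isProbabilityMeasure_map f.measurable.aemeasurable
  choose ρ hρ hρz using exists_cauchyTransform_eq_inv_sub ν f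
  obtain ⟨l, hl, hlz⟩ := exists_cauchyTransform_eq_sum k.range
    (fun y _ => measureReal_nonneg) (sum_measureReal_preimage_singleton_range μ k) ρ
  refine ⟨l, hl, fun z hz => ?_⟩
  rw [hlz z hz.ne', cauchyTransform_map_simpleFunc μ k (inv_cauchyTransform_im_pos _ hz).ne']
  exact Finset.sum_congr rfl fun y _ => by rw [hρz y z hz]

/-! ### Limits -/

lemma tendsto_mul_cauchyTransform (ρ : Measure ℝ) [IsProbabilityMeasure ρ] {w : ℝ → ℂ}
    (hw : Tendsto (fun y : ℝ => w y / y) atTop (𝓝 I)) :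
    Tendsto (fun y => w y * cauchyTransform ρ (w y)) atTop (𝓝 1) := by
  have him : Tendsto (fun y : ℝ => (w y).im / y) atTop (𝓝 1) := by
    simpa [Function.comp_def, div_ofReal_im] using (Complex.continuous_im.tendsto I).comp hw
  have hnorm : Tendsto (fun y : ℝ => ‖w y / y‖) atTop (𝓝 1) := by
    simpa using hw.norm
  have hev : ∀ᶠ y : ℝ in atTop, 0 < y ∧ y / 2 ≤ (w y).im ∧ ‖w y‖ ≤ 2 * y := by
    filter_upwards [eventually_gt_atTop 0, him.eventually (lt_mem_nhds one_half_lt_one),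
      hnorm.eventually (gt_mem_nhds one_lt_two)] with y hy h1 h2
    rw [lt_div_iff₀ hy] at h1
    rw [norm_div, norm_real, Real.norm_of_nonneg hy.le, div_lt_iff₀ hy] at h2
    exact ⟨hy, by linarith, h2.le⟩
  have hlim : Tendsto (fun y => ∫ t, w y * (w y - (t : ℂ))⁻¹ ∂ρ) atTop (𝓝 (∫ _, 1 ∂ρ)) := by
    refine tendsto_integral_filter_of_dominated_convergence (fun _ => 4) ?_ ?_
      (integrable_const _) ?_
    · filter_upwards [hev] with y ⟨hy, h1, _⟩
      exact ((continuous_inv_sub_ofReal (by linarith)).const_mul _).aestronglyMeasurable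
    · filter_upwards [hev] with y ⟨hy, h1, h2⟩
      refine Eventually.of_forall fun t => ?_
      have hne : (w y).im ≠ 0 := by linarith
      have h3 : |(w y).im|⁻¹ ≤ (y / 2)⁻¹ :=
        inv_anti₀ (by positivity) (h1.trans (le_abs_self _))
      calc ‖w y * (w y - (t : ℂ))⁻¹‖ ≤ (2 * y) * (y / 2)⁻¹ := by
            rw [norm_mul]
            gcongr
            exact (norm_inv_sub_ofReal_le hne t).trans h3
        _ = 4 := by field_simp; norm_num
    · refine Eventually.of_forall fun t => ?_
      have h0 : Tendsto (fun y : ℝ => (t : ℂ) / y) atTop (𝓝 0) := by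
        have : Tendsto (fun y : ℝ => ((t / y : ℝ) : ℂ)) atTop (𝓝 ((0 : ℝ) : ℂ)) :=
          (Complex.continuous_ofReal.tendsto 0).comp (tendsto_id.const_div_atTop t)
        simpa using this
      have h1 : Tendsto (fun y : ℝ => w y / y * (w y / y - (t : ℂ) / y)⁻¹) atTop
          (𝓝 (I * (I - 0)⁻¹)) := hw.mul ((hw.sub h0).inv₀ (by simp))
      rw [sub_zero, mul_inv_cancel₀ I_ne_zero] at h1
      refine h1.congr' ?_
      filter_upwards [hev] with y ⟨hy, h1, _⟩
      have hne : (w y).im ≠ 0 := by linarith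
      have := sub_ofReal_ne_zero hne t
      have hy' : (y : ℂ) ≠ 0 := by exact_mod_cast hy.ne'
      rw [← sub_div]
      field_simp
  simpa [cauchyTransform, integral_const_mul] using hlim

lemma tendsto_mul_cauchyTransform_comp (μ ν : Measure ℝ) [IsProbabilityMeasure μ]
    [IsProbabilityMeasure ν] :
    Tendsto (fun y : ℝ => (y * I) * cauchyTransform μ (cauchyTransform ν (y * I))⁻¹) atTop
      (𝓝 1) := by
  have h1 : Tendsto (fun y : ℝ => (y * I) * cauchyTransform ν (y * I)) atTop (𝓝 1) := by
    refine tendsto_mul_cauchyTransform ν (tendsto_const_nhds.congr' ?_)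
    filter_upwards [eventually_ne_atTop 0] with y hy
    have hy' : (y : ℂ) ≠ 0 := by exact_mod_cast hy
    field_simp
  have h2 : Tendsto (fun y : ℝ => (cauchyTransform ν (y * I))⁻¹ / y) atTop (𝓝 I) := by
    have := (h1.inv₀ one_ne_zero).const_mul I
    rw [inv_one, mul_one] at this
    refine this.congr' ?_
    filter_upwards [eventually_gt_atTop 0] with y hy
    have hy' : (y : ℂ) ≠ 0 := by exact_mod_cast hy.ne'
    have := cauchyTransform_ne_zero ν (z := y * I) (by simpa using hy)
    field_simp
  have h3 := (tendsto_mul_cauchyTransform μ h2).mul h1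
  rw [mul_one] at h3
  refine h3.congr' ?_
  filter_upwards [eventually_gt_atTop 0] with y hy
  have := cauchyTransform_ne_zero ν (z := y * I) (by simpa using hy)
  field_simp

lemma tendsto_cauchyTransform_map (ρ : Measure ℝ) [IsProbabilityMeasure ρ]
    {f : ℕ → SimpleFunc ℝ ℝ} (hf : ∀ t, Tendsto (fun n => f n t) atTop (𝓝 t))
    {w : ℕ → ℂ} {z : ℂ} (hz : 0 < z.im) (hw : Tendsto w atTop (𝓝 z)) :
    Tendsto (fun n => cauchyTransform (ρ.map (f n)) (w n)) atTop (𝓝 (cauchyTransform ρ z)) := by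
  have hev : ∀ᶠ n in atTop, z.im / 2 < (w n).im :=
    ((Complex.continuous_im.tendsto z).comp hw).eventually (lt_mem_nhds (half_lt_self hz))
  have hlim : Tendsto (fun n => ∫ t, (w n - (f n t : ℂ))⁻¹ ∂ρ) atTop
      (𝓝 (∫ t, (z - (t : ℂ))⁻¹ ∂ρ)) := by
    refine tendsto_integral_filter_of_dominated_convergence (fun _ => (z.im / 2)⁻¹) ?_ ?_
      (integrable_const _) ?_
    · filter_upwards [hev] with n hn
      exact ((continuous_inv_sub_ofReal (by linarith)).measurable.comp
        (f n).measurable).aestronglyMeasurable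
    · filter_upwards [hev] with n hn
      refine Eventually.of_forall fun t => ?_
      exact (norm_inv_sub_ofReal_le (by linarith) _).trans
        (inv_anti₀ (by positivity) (hn.le.trans (le_abs_self _)))
    · refine Eventually.of_forall fun t => ?_
      exact (hw.sub ((Complex.continuous_ofReal.tendsto t).comp (hf t))).inv₀
        (sub_ofReal_ne_zero hz.ne' t)
  refine hlim.congr' ?_
  filter_upwards [hev] with n hn
  rw [cauchyTransform, integral_map (f n).measurable.aemeasurable
    (continuous_inv_sub_ofReal (by linarith)).aestronglyMeasurable]

/-- The mass of a probability measure far from the origin is controlled by its Cauchy transform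
on the imaginary axis. -/
lemma measureReal_norm_gt_le (ρ : Measure ℝ) [IsProbabilityMeasure ρ] {r : ℝ} (hr : 0 < r) :
    ρ.real {t | r < ‖t‖} ≤ 2 * (1 - ((r * I) * cauchyTransform ρ (r * I)).re) := by
  have him : ((r : ℂ) * I).im ≠ 0 := by simpa using hr.ne'
  have hi := (integrable_inv_sub_ofReal ρ him).const_mul (r * I)
  have hval (t : ℝ) : 1 - ((r * I) * (r * I - (t : ℂ))⁻¹).re = t ^ 2 / (r ^ 2 + t ^ 2) := by
    have : r ^ 2 + t ^ 2 ≠ 0 := by positivity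
    simp [Complex.inv_re, Complex.inv_im, Complex.normSq_apply]
    field_simp
    ring
  have hint : 1 - ((r * I) * cauchyTransform ρ (r * I)).re =
      ∫ t, t ^ 2 / (r ^ 2 + t ^ 2) ∂ρ := by
    simp_rw [← hval]
    have hre : ((r * I) * cauchyTransform ρ (r * I)).re =
        ∫ t : ℝ, ((r * I) * (r * I - (t : ℂ))⁻¹).re ∂ρ := by
      rw [cauchyTransform, ← integral_const_mul]
      exact (Complex.reCLM.integral_comp_comm hi).symm
    refine Eq.trans ?_ (integral_sub (integrable_const 1) hi.re).symm
    rw [hre]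
    simp
  have hi' : Integrable (fun t : ℝ => t ^ 2 / (r ^ 2 + t ^ 2)) ρ := by
    simp_rw [← hval]
    exact (integrable_const _).sub hi.re
  have hmarkov := mul_meas_ge_le_integral_of_nonneg (μ := ρ)
    (f := fun t : ℝ => t ^ 2 / (r ^ 2 + t ^ 2))
    (Eventually.of_forall fun t => by positivity) hi' (1 / 2)
  have hmono : ρ.real {t | r < ‖t‖} ≤ ρ.real {t | 1 / 2 ≤ t ^ 2 / (r ^ 2 + t ^ 2)} := by
    refine measureReal_mono fun t ht => ?_
    have ht' : r < |t| := ht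
    have : r ^ 2 ≤ t ^ 2 := by
      rw [← sq_abs t]
      gcongr
    change 1 / 2 ≤ t ^ 2 / (r ^ 2 + t ^ 2)
    rw [div_le_div_iff₀ two_pos (by positivity)]
    linarith
  rw [hint]
  linarith

/-- A pointwise limit of Cauchy transforms of probability measures, with the right behaviour at
infinity, is again the Cauchy transform of a probability measure. -/
theorem exists_cauchyTransform_eq_of_tendsto {l : ℕ → Measure ℝ}
    [hl : ∀ n, IsProbabilityMeasure (l n)] {H : ℂ → ℂ}
    (hlim : ∀ z : ℂ, 0 < z.im → Tendsto (fun n => cauchyTransform (l n) z) atTop (𝓝 (H z)))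
    (hH : Tendsto (fun y : ℝ => (y * I) * H (y * I)) atTop (𝓝 1)) :
    ∃ ρ : Measure ℝ, IsProbabilityMeasure ρ ∧
      ∀ z : ℂ, 0 < z.im → cauchyTransform ρ z = H z := by
  have htight : IsTightMeasureSet (Set.range l) := by
    apply isTightMeasureSet_range_of_tendsto_limsup_measure_norm_gt
    have hbound : Tendsto (fun r : ℝ => ENNReal.ofReal (2 * (1 - ((r * I) * H (r * I)).re)))
        atTop (𝓝 0) := by
      have h1 := (((Complex.continuous_re.tendsto 1).comp hH).const_sub 1).const_mul 2
      have h2 := (ENNReal.continuous_ofReal.tendsto _).comp h1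
      rwa [one_re, sub_self, mul_zero, ENNReal.ofReal_zero] at h2
    refine tendsto_of_tendsto_of_tendsto_of_le_of_le' tendsto_const_nhds hbound
      (Eventually.of_forall fun _ => zero_le) ?_
    filter_upwards [eventually_gt_atTop 0] with r hr
    have hr' : 0 < ((r : ℂ) * I).im := by simpa using hr
    have h1 := ((((Complex.continuous_re.tendsto _).comp
      ((hlim _ hr').const_mul (r * I))).const_sub 1).const_mul 2)
    rw [← ((ENNReal.continuous_ofReal.tendsto _).comp h1).limsup_eq]
    refine limsup_le_limsup (Eventually.of_forall fun n => ?_)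
    change l n {t | r < ‖t‖} ≤ _
    rw [Function.comp_apply, ← ofReal_measureReal (measure_ne_top (l n) _)]
    exact ENNReal.ofReal_le_ofReal (measureReal_norm_gt_le (l n) hr)
  let P : ℕ → ProbabilityMeasure ℝ := fun n => ⟨l n, hl n⟩
  have hcomp : IsCompact (closure (Set.range P)) := by
    apply isCompact_closure_of_isTightMeasureSet
    convert htight
    ext ρ
    constructor
    · rintro ⟨_, ⟨n, rfl⟩, rfl⟩
      exact ⟨n, rfl⟩
    · rintro ⟨n, rfl⟩
      exact ⟨P n, ⟨n, rfl⟩, rfl⟩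
  obtain ⟨ρ, -, φ, hφ, hρ⟩ := hcomp.isSeqCompact fun n => subset_closure (Set.mem_range_self n)
  refine ⟨ρ, inferInstance, fun z hz => ?_⟩
  rw [ProbabilityMeasure.tendsto_iff_forall_integral_rclike_tendsto ℂ] at hρ
  exact tendsto_nhds_unique (hρ (resolventBCF ⟨z, hz.ne'⟩)) ((hlim z hz).comp hφ.tendsto_atTop)

end CauchyTransform

open CauchyTransform in
/-- Existence and uniqueness of the additive monotone convolution `μ ▷ ν`: the unique
probability measure `λ` on `ℝ` with `G_λ(z) = G_μ(1/G_ν(z))`, i.e. `F_λ = F_μ ∘ F_ν`,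
on the upper half-plane. -/
theorem monotone_additive_convolution_exists_unique
    (μ ν : Measure ℝ) [IsProbabilityMeasure μ] [IsProbabilityMeasure ν] :
    ∃! l : Measure ℝ, IsProbabilityMeasure l ∧
      ∀ z : ℂ, 0 < z.im →
        cauchyTransform l z = cauchyTransform μ ((cauchyTransform ν z)⁻¹) := by
  let f := SimpleFunc.approxOn (id : ℝ → ℝ) measurable_id Set.univ 0 (Set.mem_univ 0)
  have hf (t : ℝ) : Tendsto (fun n => f n t) atTop (𝓝 t) :=
    SimpleFunc.tendsto_approxOn measurable_id (Set.mem_univ 0) (by simp)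
  choose l hl hlz using fun n => exists_cauchyTransform_comp_map_simpleFunc μ ν (f n) (f n)
  obtain ⟨ρ, hρ, hρz⟩ := exists_cauchyTransform_eq_of_tendsto (l := l)
    (H := fun z => cauchyTransform μ (cauchyTransform ν z)⁻¹) (fun z hz => by
      simp_rw [fun n => hlz n z hz]
      exact tendsto_cauchyTransform_map μ hf (inv_cauchyTransform_im_pos ν hz)
        ((tendsto_cauchyTransform_map ν hf hz tendsto_const_nhds).inv₀
          (cauchyTransform_ne_zero ν hz)))
    (tendsto_mul_cauchyTransform_comp μ ν)
  refine ⟨ρ, ⟨hρ, hρz⟩, fun σ ⟨hσ, hσz⟩ => ext_of_cauchyTransform fun z hz => ?_⟩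
  rw [hσz z hz, hρz z hz]
end

section
/- Let μ and ν be Borel probability measures on ℝ supported on [0,∞) with ν ≠ δ₀, and let W_ν(z) = ∫ √t/(z−t) dν(t) for z ∈ ℂ∖ℝ. Then there exists a unique Borel probability measure λ on ℝ, supported on [0,∞), such that for all z ∈ ℂ⁺: G_λ(z) = G_ν(z) − W_ν(z)²/(z·G_ν(z)−1) + [W_ν(z)²/(z·G_ν(z)−1)²] · G_μ(z·G_ν(z)/(z·G_ν(z)−1)). (λ is the alternative multiplicative monotone convolution μ ▷̃ ν, the distribution of √Y X √Y for monotonically independent X−1, Y with distributions μ, ν.) -/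
open MeasureTheory

/-- The transform `W_ρ(z) = ∫ √t/(z−t) dρ(t)` of a measure on `ℝ`. -/
noncomputable def sqrtCauchyTransform (ρ : Measure ℝ) (z : ℂ) : ℂ :=
  ∫ t, (Real.sqrt t : ℂ) / (z - (t : ℂ)) ∂ρ

open Filter Topology ProbabilityTheory Matrix
open scoped NNReal ENNReal

theorem norm_inv_sub_le {z : ℂ} (hz : z.im ≠ 0) (t : ℝ) : ‖(z - t)⁻¹‖ ≤ |z.im|⁻¹ := by
  rw [norm_inv]
  gcongr
  simpa using Complex.abs_im_le_norm (z - t)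

theorem integrable_inv_sub (ρ : Measure ℝ) [IsFiniteMeasure ρ] {z : ℂ} (hz : z.im ≠ 0) :
    Integrable (fun t : ℝ => (z - t)⁻¹) ρ :=
  .of_bound (by fun_prop) |z.im|⁻¹ (.of_forall fun t => norm_inv_sub_le hz t)

theorem charFun_cauchyMeasure_zero {ε : ℝ≥0} (hε : ε ≠ 0) (t : ℝ) :
    charFun (cauchyMeasure 0 ε) t = charFun (cauchyMeasure 0 1) (ε * t) := by
  have key : ∀ (γ : ℝ≥0), γ ≠ 0 → ∀ s : ℝ, charFun (cauchyMeasure 0 γ) s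
      = ∫ x : ℝ, cauchyPDFReal 0 γ x • Complex.exp (s * x * Complex.I) := by
    intro γ hγ s
    rw [charFun_apply_real, cauchyMeasure_of_scale_ne_zero _ hγ,
      integral_withDensity_eq_integral_toReal_smul (by fun_prop)
        (.of_forall fun x => by simp [cauchyPDF])]
    refine integral_congr_ae (.of_forall fun x => ?_)
    simp [cauchyPDF, ENNReal.toReal_ofReal (cauchyPDF_pos 0 hγ x).le]
  rw [key ε hε, key 1 one_ne_zero]
  have h := Measure.integral_comp_mul_left
    (fun x : ℝ => cauchyPDFReal 0 ε x • Complex.exp (t * x * Complex.I)) ε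
  have hε' : (0 : ℝ) < ε := by positivity
  rw [abs_of_pos (inv_pos.2 hε'), eq_inv_smul_iff₀ hε'.ne', ← integral_smul] at h
  rw [← h]
  refine integral_congr_ae (.of_forall fun x => ?_)
  simp only [smul_smul]
  congr 1
  · simp only [cauchyPDFReal_def]
    simp
    field
  · push_cast; ring_nf

theorem cauchyPDFReal_sub_eq (ε : ℝ≥0) (x t : ℝ) :
    cauchyPDFReal 0 ε (x - t) = -(Real.pi⁻¹ * ((x + ε * Complex.I - t : ℂ)⁻¹).im) := by
  simp [cauchyPDFReal_def, Complex.normSq_apply]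
  ring

theorem conv_cauchyMeasure_eq_withDensity (ρ : Measure ℝ) [IsFiniteMeasure ρ] {ε : ℝ≥0}
    (hε : ε ≠ 0) :
    ρ ∗ cauchyMeasure 0 ε = volume.withDensity fun x : ℝ =>
      ENNReal.ofReal (-(Real.pi⁻¹ * (cauchyTransform ρ (x + ε * Complex.I)).im)) := by
  have hdens : ∀ x : ℝ, ENNReal.ofReal (-(Real.pi⁻¹ *
      (cauchyTransform ρ (x + ε * Complex.I)).im)) = ∫⁻ t, cauchyPDF 0 ε (x - t) ∂ρ := by
    intro x
    have hint : Integrable (fun t : ℝ => (x + ε * Complex.I - t : ℂ)⁻¹) ρ :=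
      integrable_inv_sub ρ (by simpa using hε)
    simp only [cauchyPDF]
    rw [← ofReal_integral_eq_lintegral_ofReal _
      (.of_forall fun t => (cauchyPDF_pos 0 hε (x - t)).le)]
    · simp only [cauchyPDFReal_sub_eq, integral_neg, integral_const_mul]
      rw [cauchyTransform]
      congr 3
      exact (integral_im hint).symm
    · simp only [cauchyPDFReal_sub_eq]
      exact (hint.im.const_mul _).neg
  ext B hB
  rw [withDensity_apply _ hB]
  simp only [hdens]
  rw [← lintegral_indicator_one hB, Measure.lintegral_conv (by fun_prop (disch := assumption)),
    cauchyMeasure_of_scale_ne_zero _ hε, ← lintegral_indicator hB]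
  have : ∀ t : ℝ, ∫⁻ y, B.indicator 1 (t + y) ∂volume.withDensity (cauchyPDF 0 ε)
      = ∫⁻ x, B.indicator 1 x * cauchyPDF 0 ε (x - t) := by
    intro t
    have hm : Measurable fun y => B.indicator (1 : ℝ → ℝ≥0∞) (t + y) :=
      (measurable_one.indicator hB).comp (measurable_const_add t)
    rw [lintegral_withDensity_eq_lintegral_mul _ (by fun_prop) hm,
      ← lintegral_sub_right_eq_self _ t]
    refine lintegral_congr fun x => ?_
    simp [mul_comm]
  simp only [this]
  rw [lintegral_lintegral_swap]
  · refine lintegral_congr fun x => ?_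
    rw [lintegral_const_mul _ (by fun_prop)]
    by_cases hx : x ∈ B <;> simp [hx]
  · exact Measurable.aemeasurable (((measurable_one.indicator hB).comp measurable_snd).mul
      ((measurable_cauchyPDF 0 ε).comp (measurable_snd.sub measurable_fst)))

/-- The Cauchy transform on the upper half-plane determines a finite measure. -/
theorem eq_of_cauchyTransform_eq {ρ σ : Measure ℝ} [IsFiniteMeasure ρ] [IsFiniteMeasure σ]
    (h : ∀ z : ℂ, 0 < z.im → cauchyTransform ρ z = cauchyTransform σ z) : ρ = σ := by
  have hconv : ∀ ε : ℝ≥0, ε ≠ 0 → ρ ∗ cauchyMeasure 0 ε = σ ∗ cauchyMeasure 0 ε := by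
    intro ε hε
    rw [conv_cauchyMeasure_eq_withDensity ρ hε, conv_cauchyMeasure_eq_withDensity σ hε]
    congr 1
    funext x
    rw [h _ (by simpa using pos_iff_ne_zero.2 hε)]
  refine Measure.ext_of_charFun (funext fun t => ?_)
  have hlim : Tendsto (fun ε : ℝ≥0 => charFun (cauchyMeasure 0 1) (ε * t)) (𝓝[>] 0) (𝓝 1) := by
    have hc : Continuous fun ε : ℝ≥0 => charFun (cauchyMeasure 0 1) (ε * t) :=
      continuous_charFun.comp (by fun_prop)
    have := hc.tendsto 0
    simp at this
    exact this.mono_left nhdsWithin_le_nhds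
  obtain ⟨ε, hε1, hε⟩ := ((hlim.eventually_ne one_ne_zero).and self_mem_nhdsWithin).exists
  have hε0 : ε ≠ 0 := pos_iff_ne_zero.1 hε
  have := congrArg (fun m => charFun m t) (hconv ε hε0)
  simp only [charFun_conv, charFun_cauchyMeasure_zero hε0] at this
  exact mul_right_cancel₀ hε1 this

/-- Spectral measure of a positive semidefinite real matrix at a unit vector `v`: its Cauchy
transform at `z` is `⟪v, u⟫` for any solution `u` of `(z - A) u = v`. -/
theorem exists_spectralMeasure {ι : Type*} [Fintype ι] [DecidableEq ι] {A : Matrix ι ι ℝ}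
    (hA : A.PosSemidef) {v : ι → ℝ} (hv : ∑ i, v i ^ 2 = 1) :
    ∃ l : Measure ℝ, IsProbabilityMeasure l ∧ l (Set.Iio 0) = 0 ∧
      ∀ (z : ℂ) (u : ι → ℂ), z.im ≠ 0 →
        (∀ i, z * u i - ∑ k, (A i k : ℂ) * u k = v i) →
        cauchyTransform l z = ∑ i, (v i : ℂ) * u i := by
  set b := hA.isHermitian.eigenvectorBasis with hb
  set ev := hA.isHermitian.eigenvalues with hev
  set c : ι → ℝ := fun j => ∑ i, b j i * v i with hc
  have hexp : ∀ i, v i = ∑ j, c j * b j i := by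
    intro i
    have h := congrArg (fun w : EuclideanSpace ℝ ι => w i) (b.sum_repr (WithLp.toLp 2 v))
    simp only [b.repr_apply_apply] at h
    simp [PiLp.inner_apply] at h
    rw [← h]
    simp [c, mul_comm]
  have hsum : ∑ j, c j ^ 2 = 1 := by
    calc ∑ j, c j ^ 2 = ∑ j, ∑ i, c j * (b j i * v i) := by
          simp only [← Finset.mul_sum, sq]; rfl
      _ = ∑ i, v i * ∑ j, c j * b j i := by
          rw [Finset.sum_comm]
          simp only [Finset.mul_sum]
          exact Finset.sum_congr rfl fun i _ => Finset.sum_congr rfl fun j _ => by ring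
      _ = 1 := by rw [← hv]; exact Finset.sum_congr rfl fun i _ => by rw [← hexp, sq]
  refine ⟨∑ j, ENNReal.ofReal (c j ^ 2) • Measure.dirac (ev j), ⟨?_⟩, ?_, ?_⟩
  · simp [← ENNReal.ofReal_sum_of_nonneg fun j _ => sq_nonneg (c j), hsum]
  · simp only [Measure.coe_finsetSum, Finset.sum_apply, Measure.smul_apply, smul_eq_mul]
    refine Finset.sum_eq_zero fun j _ => ?_
    simp [Measure.dirac_apply' _ measurableSet_Iio, not_lt.2 (hA.eigenvalues_nonneg j), ev]
  · intro z u hz hu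
    have hne : ∀ j, z - ev j ≠ 0 := fun j h => hz (by simpa using congrArg Complex.im h)
    have hcoef : ∀ j, (c j : ℂ) = (z - ev j) * ∑ i, (b j i : ℂ) * u i := by
      intro j
      have hAb : ∀ k, ∑ i, (A i k : ℂ) * b j i = ev j * b j k := by
        intro k
        have h := congrFun (hA.isHermitian.mulVec_eigenvectorBasis j) k
        simp only [Matrix.mulVec, dotProduct, Pi.smul_apply, smul_eq_mul] at h
        rw [← Complex.ofReal_mul, ← h]
        push_cast
        refine Finset.sum_congr rfl fun i _ => ?_
        rw [← hA.isHermitian.apply i k]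
        simp [b]
      calc (c j : ℂ) = ∑ i, (b j i : ℂ) * (z * u i - ∑ k, (A i k : ℂ) * u k) := by
            simp [c, hu]
        _ = z * ∑ i, (b j i : ℂ) * u i - ∑ k, (∑ i, (A i k : ℂ) * b j i) * u k := by
            simp only [mul_sub, Finset.sum_sub_distrib, Finset.mul_sum, Finset.sum_mul]
            rw [Finset.sum_comm (f := fun i k => (b j i : ℂ) * ((A i k : ℂ) * u k))]
            congr 1
            · exact Finset.sum_congr rfl fun i _ => by ring
            · exact Finset.sum_congr rfl fun i _ => Finset.sum_congr rfl fun j _ => by ring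
        _ = _ := by
            simp only [hAb, mul_assoc, ← Finset.mul_sum, sub_mul]
    have hint : ∀ j ∈ Finset.univ, Integrable (fun t : ℝ => (z - t)⁻¹)
        (ENNReal.ofReal (c j ^ 2) • Measure.dirac (ev j)) := fun j _ =>
      (integrable_inv_sub _ hz).smul_measure ENNReal.ofReal_ne_top
    rw [cauchyTransform, integral_finsetSum_measure hint]
    simp only [integral_smul_measure, integral_dirac, ENNReal.toReal_ofReal (sq_nonneg _)]
    calc ∑ j, (c j ^ 2) • (z - ev j)⁻¹ = ∑ j, (c j : ℂ) * ∑ i, (b j i : ℂ) * u i := by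
          refine Finset.sum_congr rfl fun j _ => ?_
          rw [Complex.real_smul]
          push_cast
          rw [← div_eq_mul_inv, div_eq_iff (hne j), sq]
          nth_rewrite 2 [hcoef j]
          ring
      _ = ∑ i, (∑ j, (c j : ℂ) * b j i) * u i := by
          simp only [Finset.mul_sum, Finset.sum_mul]
          rw [Finset.sum_comm]
          exact Finset.sum_congr rfl fun i _ => Finset.sum_congr rfl fun j _ => by ring
      _ = _ := by
          refine Finset.sum_congr rfl fun i _ => ?_
          rw [hexp i]
          push_cast
          rfl

/-- The rank-one perturbation `√Y (1 + (x - 1) P) √Y` of a finite diagonal matrix `Y`, with `P` the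
projection onto `v`. -/
theorem posSemidef_rankOnePerturbation {ι : Type*} [Fintype ι] [DecidableEq ι] {v t : ι → ℝ}
    (hv : ∑ i, v i ^ 2 = 1) (ht : ∀ i, 0 ≤ t i) {x : ℝ} (hx : 0 ≤ x) :
    (Matrix.diagonal t + (x - 1) • Matrix.vecMulVec (fun i => √(t i) * v i)
      (fun i => √(t i) * v i)).PosSemidef := by
  refine Matrix.PosSemidef.of_dotProduct_mulVec_nonneg ?_ fun w => ?_
  · ext i k
    simp [Matrix.diagonal_apply, Matrix.vecMulVec_apply]
    grind
  · have hcs := Finset.sum_mul_sq_le_sq_mul_sq Finset.univ v (fun i => √(t i) * w i)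
    rw [hv, one_mul] at hcs
    have h1 : ∀ i, (√(t i) * w i) ^ 2 = t i * w i ^ 2 := fun i => by
      rw [mul_pow, Real.sq_sqrt (ht i)]
    simp only [h1] at hcs
    have h2 : star w ⬝ᵥ (Matrix.diagonal t + (x - 1) • Matrix.vecMulVec (fun i => √(t i) * v i)
        (fun i => √(t i) * v i)) *ᵥ w
        = ∑ i, t i * w i ^ 2 + (x - 1) * (∑ i, v i * (√(t i) * w i)) ^ 2 := by
      have hrow : ∀ i, ((Matrix.diagonal t + (x - 1) • Matrix.vecMulVec (fun i => √(t i) * v i)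
          (fun i => √(t i) * v i)) *ᵥ w) i
          = t i * w i + (x - 1) * (√(t i) * v i) * ∑ k, v k * (√(t k) * w k) := by
        intro i
        simp only [Matrix.mulVec, dotProduct, Matrix.add_apply, Matrix.smul_apply,
          Matrix.vecMulVec_apply, smul_eq_mul, add_mul, Finset.sum_add_distrib, Finset.mul_sum]
        congr 1
        · simp [Matrix.diagonal_apply]
        · exact Finset.sum_congr rfl fun k _ => by ring
      simp only [dotProduct, hrow, star_trivial, mul_add, Finset.sum_add_distrib, sq]
      congr 1
      · exact Finset.sum_congr rfl fun i _ => by ring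
      · rw [← mul_assoc, Finset.mul_sum]
        exact Finset.sum_congr rfl fun i _ => by ring
    rw [h2]
    nlinarith [mul_nonneg hx (sq_nonneg (∑ i, v i * (√(t i) * w i)))]

theorem im_div_sub (z : ℂ) (t : ℝ) :
    ((t : ℂ) / (z - t)).im = -(z.im * (t / Complex.normSq (z - t))) := by
  simp [Complex.div_im]
  ring

theorem exists_measure_of_finite {ι : Type*} [Fintype ι] {p t : ι → ℝ}
    (hp : ∀ i, 0 ≤ p i) (hp1 : ∑ i, p i = 1) (ht : ∀ i, 0 ≤ t i) {x : ℝ} (hx : 0 ≤ x) :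
    ∃ l : Measure ℝ, IsProbabilityMeasure l ∧ l (Set.Iio 0) = 0 ∧
      ∀ z : ℂ, 0 < z.im → cauchyTransform l z =
        ∑ i, (p i : ℂ) * (z - t i)⁻¹ - (∑ i, (p i : ℂ) * (√(t i) / (z - t i))) ^ 2 *
          ((1 - x) / (1 + (1 - x) * (z * ∑ i, (p i : ℂ) * (z - t i)⁻¹ - 1))) := by
  classical
  have hv : ∑ i, √(p i) ^ 2 = 1 := by simp [Real.sq_sqrt, hp, hp1]
  obtain ⟨l, hl, hl0, h⟩ := exists_spectralMeasure (posSemidef_rankOnePerturbation hv ht hx) hv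
  refine ⟨l, hl, hl0, fun z hz => ?_⟩
  have hne : ∀ i, z - t i ≠ 0 := fun i h => hz.ne' (by simpa using congrArg Complex.im h)
  have hpp : ∀ i, (√(p i) : ℂ) * √(p i) = p i := fun i => by
    rw [← Complex.ofReal_mul, Real.mul_self_sqrt (hp i)]
  have htt : ∀ i, (√(t i) : ℂ) * √(t i) = t i := fun i => by
    rw [← Complex.ofReal_mul, Real.mul_self_sqrt (ht i)]
  set G := ∑ i, (p i : ℂ) * (z - t i)⁻¹ with hG
  set W := ∑ i, (p i : ℂ) * (√(t i) / (z - t i)) with hW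
  have hD : z * G - 1 = ∑ i, (p i : ℂ) * (t i / (z - t i)) := by
    have : (1 : ℂ) = ∑ i, (p i : ℂ) := by exact_mod_cast hp1.symm
    rw [this, hG, Finset.mul_sum, ← Finset.sum_sub_distrib]
    refine Finset.sum_congr rfl fun i _ => ?_
    field_simp [hne i]
    ring
  set D := z * G - 1
  have hden : 1 + (1 - x) * D ≠ 0 := by
    intro h0
    have him : (1 - x) * D.im = 0 := by simpa using congrArg Complex.im h0
    have hDim : D.im = -(z.im * ∑ i, p i * (t i / Complex.normSq (z - t i))) := by
      rw [hD, Complex.im_sum, Finset.mul_sum, ← Finset.sum_neg_distrib]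
      refine Finset.sum_congr rfl fun i _ => ?_
      rw [Complex.im_ofReal_mul, im_div_sub]
      ring
    rcases mul_eq_zero.1 him with h1 | h1
    · have : (1 - x : ℂ) = 0 := by exact_mod_cast h1
      simp [this] at h0
    · rw [hDim, neg_eq_zero, mul_eq_zero, or_iff_right hz.ne',
        Finset.sum_eq_zero_iff_of_nonneg fun i _ => mul_nonneg (hp i)
          (div_nonneg (ht i) (Complex.normSq_nonneg _))] at h1
      have : D = 0 := by
        rw [hD]
        refine Finset.sum_eq_zero fun i hi => ?_
        have := h1 i hi
        rw [mul_eq_zero, div_eq_zero_iff, Complex.normSq_eq_zero, or_iff_left (hne i)] at this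
        rcases this with h | h <;> simp [h]
      simp [this] at h0
  set c := (x - 1) * W / (1 + (1 - x) * D) with hc
  have hcW : c = (x - 1) * (W + c * D) := by
    rw [hc]; field_simp; ring
  rw [h z (fun i => √(p i) / (z - t i) + c * (√(t i) * √(p i) / (z - t i))) hz.ne' fun i => ?_]
  · have : G - W ^ 2 * ((1 - x) / (1 + (1 - x) * D)) = G + c * W := by
      rw [hc]; ring
    rw [this, hG, hW, Finset.mul_sum, ← Finset.sum_add_distrib]
    refine Finset.sum_congr rfl fun i _ => ?_
    rw [← hpp i]; ring
  · have hS : ∑ k, (√(t k) * √(p k) : ℂ) *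
        (√(p k) / (z - t k) + c * (√(t k) * √(p k) / (z - t k))) = W + c * D := by
      rw [hD, hW, Finset.mul_sum, ← Finset.sum_add_distrib]
      refine Finset.sum_congr rfl fun i _ => ?_
      rw [← hpp i, ← htt i]; ring
    have hrow : ∀ u : ι → ℂ, ∑ k, (((Matrix.diagonal t + (x - 1) • Matrix.vecMulVec
        (fun i => √(t i) * √(p i)) (fun i => √(t i) * √(p i)) : Matrix ι ι ℝ) i k : ℝ) : ℂ) * u k
        = t i * u i + (x - 1) * (√(t i) * √(p i)) * ∑ k, (√(t k) * √(p k) : ℂ) * u k := by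
      intro u
      simp only [Matrix.add_apply, Matrix.smul_apply, Matrix.vecMulVec_apply, smul_eq_mul,
        Complex.ofReal_add, add_mul, Finset.sum_add_distrib, Matrix.diagonal_apply, Finset.mul_sum]
      congr 1
      · rw [Finset.sum_eq_single i (fun k _ hk => by simp [hk.symm]) (by simp), if_pos rfl]
      · refine Finset.sum_congr rfl fun k _ => ?_
        push_cast; ring
    rw [hrow, hS]
    have : (x - 1 : ℂ) * (√(t i) * √(p i)) * (W + c * D) = c * (√(t i) * √(p i)) := by
      rw [mul_right_comm, ← hcW]
    rw [this]
    field_simp [hne i]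
    ring

/-- A form of the Cauchy transform of the alternative multiplicative monotone convolution which is
affine in `μ`. -/
noncomputable def altConvTransform (μ ν : Measure ℝ) (z : ℂ) : ℂ :=
  cauchyTransform ν z - sqrtCauchyTransform ν z ^ 2 *
    ∫ x : ℝ, (1 - x) / (1 + (1 - x) * (z * cauchyTransform ν z - 1)) ∂μ

theorem integral_map_simpleFunc (ρ : Measure ℝ) [IsProbabilityMeasure ρ] (f : SimpleFunc ℝ ℝ)
    {φ : ℝ → ℂ} (hφ : Measurable φ) :
    ∫ x, φ x ∂(ρ.map f) = ∑ y : f.range, (ρ.real (f ⁻¹' {(y : ℝ)}) : ℂ) * φ y := by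
  have hf : Measurable fun x => (⟨f x, f.mem_range_self x⟩ : f.range) :=
    f.measurable.subtype_mk
  have : ∫ x, φ (f x) ∂ρ = ∫ y : f.range, φ y ∂(ρ.map fun x => ⟨f x, f.mem_range_self x⟩) := by
    exact (integral_map hf.aemeasurable
      (hφ.comp measurable_subtype_coe).stronglyMeasurable.aestronglyMeasurable).symm
  rw [integral_map f.measurable.aemeasurable hφ.stronglyMeasurable.aestronglyMeasurable, this]
  have := Measure.isProbabilityMeasure_map (μ := ρ) hf.aemeasurable
  rw [integral_fintype .of_finite]
  refine Finset.sum_congr rfl fun y _ => ?_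
  have hset : (fun x => (⟨f x, f.mem_range_self x⟩ : f.range)) ⁻¹' {y} = f ⁻¹' {(y : ℝ)} := by
    ext x
    simp [Subtype.ext_iff]
  rw [map_measureReal_apply hf (measurableSet_singleton y), Complex.real_smul, hset]

theorem sum_measureReal_preimage_range (ρ : Measure ℝ) [IsProbabilityMeasure ρ]
    (f : SimpleFunc ℝ ℝ) : ∑ y : f.range, ρ.real (f ⁻¹' {(y : ℝ)}) = 1 := by
  have h := integral_map_simpleFunc ρ f (φ := fun _ => 1) measurable_const
  have := Measure.isProbabilityMeasure_map (μ := ρ) f.measurable.aemeasurable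
  simp at h
  exact_mod_cast h.symm

theorem exists_measure_of_simpleFunc (μ ν : Measure ℝ) [IsProbabilityMeasure μ]
    [IsProbabilityMeasure ν] {f g : SimpleFunc ℝ ℝ} (hf : ∀ x, 0 ≤ f x) (hg : ∀ x, 0 ≤ g x) :
    ∃ l : Measure ℝ, IsProbabilityMeasure l ∧ l (Set.Iio 0) = 0 ∧
      ∀ z : ℂ, 0 < z.im → cauchyTransform l z = altConvTransform (μ.map g) (ν.map f) z := by
  have hrange : ∀ h : SimpleFunc ℝ ℝ, (∀ x, 0 ≤ h x) → ∀ y : h.range, 0 ≤ (y : ℝ) := by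
    rintro h hh ⟨y, hy⟩
    obtain ⟨x, rfl⟩ := SimpleFunc.mem_range.1 hy
    exact hh x
  choose l hl hl0 h using fun k : g.range => exists_measure_of_finite
    (fun y : f.range => measureReal_nonneg (μ := ν) (s := f ⁻¹' {(y : ℝ)}))
    (sum_measureReal_preimage_range ν f) (hrange f hf) (hrange g hg k)
  set q : g.range → ℝ := fun k => μ.real (g ⁻¹' {(k : ℝ)})
  have hq : ∑ k, q k = 1 := sum_measureReal_preimage_range μ g
  have hq0 : ∀ k, 0 ≤ q k := fun k => measureReal_nonneg
  refine ⟨∑ k, ENNReal.ofReal (q k) • l k, ⟨?_⟩, ?_, fun z hz => ?_⟩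
  · simpa [← ENNReal.ofReal_sum_of_nonneg fun j _ => hq0 j] using hq
  · simp [hl0]
  · have hint : ∀ k ∈ Finset.univ, Integrable (fun t : ℝ => (z - t)⁻¹)
        (ENNReal.ofReal (q k) • l k) := fun k _ =>
      (integrable_inv_sub _ hz.ne').smul_measure ENNReal.ofReal_ne_top
    rw [cauchyTransform, integral_finsetSum_measure hint]
    have hG : cauchyTransform (ν.map f) z = _ :=
      integral_map_simpleFunc ν f (φ := fun t : ℝ => (z - t)⁻¹) (by fun_prop)
    have hW : sqrtCauchyTransform (ν.map f) z = _ :=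
      integral_map_simpleFunc ν f (φ := fun t : ℝ => √t / (z - t)) (by fun_prop)
    rw [altConvTransform, integral_map_simpleFunc μ g
      (φ := fun x : ℝ => (1 - x) / (1 + (1 - x) * (z * cauchyTransform (ν.map f) z - 1)))
      (by fun_prop)]
    have hq' : ∑ k, (q k : ℂ) = 1 := by exact_mod_cast hq
    simp only [integral_smul_measure, ENNReal.toReal_ofReal (hq0 _), Complex.real_smul]
    have hl' : ∀ k, ∫ t : ℝ, (z - t)⁻¹ ∂l k = _ := fun k => h k z hz
    simp only [hl', ← hG, ← hW]
    rw [Finset.mul_sum]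
    simp only [mul_sub (q _ : ℂ), Finset.sum_sub_distrib]
    rw [← Finset.sum_mul, hq', one_mul]
    congr 1
    exact Finset.sum_congr rfl fun k _ => mul_left_comm _ _ _

theorem mul_inv_sub_sub_one {z : ℂ} (hz : z.im ≠ 0) (t : ℝ) :
    z * (z - t)⁻¹ - 1 = t / (z - t) := by
  have : z - t ≠ 0 := fun h => hz (by simpa using congrArg Complex.im h)
  field_simp
  ring

theorem integrable_div_sub (ρ : Measure ℝ) [IsFiniteMeasure ρ] {z : ℂ} (hz : z.im ≠ 0) :
    Integrable (fun t : ℝ => t / (z - t)) ρ := by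
  simp only [← mul_inv_sub_sub_one hz]
  exact ((integrable_inv_sub ρ hz).const_mul z).sub (integrable_const 1)

theorem mul_cauchyTransform_sub_one (ρ : Measure ℝ) [IsProbabilityMeasure ρ] {z : ℂ}
    (hz : z.im ≠ 0) : z * cauchyTransform ρ z - 1 = ∫ t : ℝ, t / (z - t) ∂ρ := by
  simp only [← mul_inv_sub_sub_one hz]
  rw [integral_sub ((integrable_inv_sub ρ hz).const_mul z) (integrable_const 1),
    integral_const_mul, cauchyTransform]
  simp

theorem ae_nonneg_of_measure_Iio_zero {ρ : Measure ℝ} (hρ : ρ (Set.Iio 0) = 0) :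
    ∀ᵐ t ∂ρ, 0 ≤ t := by
  rw [ae_iff]
  simpa [Set.Iio] using hρ

theorem im_mul_cauchyTransform_sub_one_neg {ρ : Measure ℝ} [IsProbabilityMeasure ρ]
    (hρ : ρ (Set.Iio 0) = 0) (hρ0 : ρ ≠ Measure.dirac 0) {z : ℂ} (hz : 0 < z.im) :
    (z * cauchyTransform ρ z - 1).im < 0 := by
  have hint := integrable_div_sub ρ hz.ne'
  have hpos := ae_nonneg_of_measure_Iio_zero hρ
  have hle : ∀ᵐ t : ℝ ∂ρ, 0 ≤ -((t : ℂ) / (z - t)).im := by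
    filter_upwards [hpos] with t ht
    rw [im_div_sub, neg_neg]
    exact mul_nonneg hz.le (div_nonneg ht (Complex.normSq_nonneg _))
  have him : (z * cauchyTransform ρ z - 1).im = -∫ t : ℝ, -((t : ℂ) / (z - t)).im ∂ρ := by
    rw [mul_cauchyTransform_sub_one ρ hz.ne', integral_neg, neg_neg]
    exact (integral_im hint).symm
  rw [him, neg_lt_zero]
  refine (integral_nonneg_of_ae hle).lt_of_ne' fun h0 => hρ0 ?_
  rw [integral_eq_zero_iff_of_nonneg_ae hle hint.im.neg] at h0
  have h1 : ∀ᵐ t : ℝ ∂ρ, t = 0 := by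
    filter_upwards [h0] with t ht
    have hne : Complex.normSq (z - t) ≠ 0 := fun h =>
      hz.ne' (by simpa using congrArg Complex.im (Complex.normSq_eq_zero.1 h))
    have : ((t : ℂ) / (z - t)).im = 0 := by simpa using ht
    rw [im_div_sub] at this
    simpa [hz.ne', hne] using this
  have h2 : ρ.map id = ρ.map fun _ => 0 := Measure.map_congr h1
  simpa [Measure.map_const] using h2

theorem norm_sqrt_div_sub_le {z : ℂ} (hz : z.im ≠ 0) (t : ℝ) :
    ‖(√t : ℂ) / (z - t)‖ ≤ |z.im|⁻¹ + (‖z‖ * |z.im|⁻¹ + 1) := by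
  have h1 := norm_inv_sub_le hz t
  have h2 : ‖(t : ℂ) / (z - t)‖ ≤ ‖z‖ * |z.im|⁻¹ + 1 := by
    rw [← mul_inv_sub_sub_one hz]
    refine (norm_sub_le _ _).trans ?_
    rw [norm_mul, norm_one]
    gcongr
  have h3 : √t ≤ 1 + |t| := by
    refine Real.sqrt_le_iff.2 ⟨by positivity, ?_⟩
    nlinarith [le_abs_self t, abs_nonneg t, sq_nonneg |t|]
  calc ‖(√t : ℂ) / (z - t)‖ = √t * ‖(z - t)⁻¹‖ := by
        rw [div_eq_mul_inv, norm_mul, Complex.norm_real, Real.norm_of_nonneg (Real.sqrt_nonneg t)]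
    _ ≤ (1 + |t|) * ‖(z - t)⁻¹‖ := by gcongr
    _ = ‖(z - t)⁻¹‖ + ‖(t : ℂ) / (z - t)‖ := by
        rw [div_eq_mul_inv, norm_mul, Complex.norm_real, Real.norm_eq_abs]; ring
    _ ≤ _ := add_le_add h1 h2

theorem norm_div_one_add_mul_le {D : ℂ} (hD : D.im ≠ 0) (a : ℝ) :
    ‖(a : ℂ) / (1 + a * D)‖ ≤ |D.im|⁻¹ := by
  rcases eq_or_ne a 0 with rfl | ha
  · simp
  have h : |a| * |D.im| ≤ ‖1 + a * D‖ := by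
    simpa [abs_mul] using Complex.abs_im_le_norm (1 + a * D)
  have h0 : 0 < |a| * |D.im| := by positivity
  rw [norm_div, Complex.norm_real, Real.norm_eq_abs, ← one_div, div_le_div_iff₀ (h0.trans_le h)
    (by positivity), one_mul]
  exact h

theorem one_add_mul_ne_zero {D : ℂ} (hD : D.im ≠ 0) (a : ℝ) : 1 + a * D ≠ 0 := by
  intro h
  have him : a * D.im = 0 := by simpa using congrArg Complex.im h
  rcases mul_eq_zero.1 him with rfl | h'
  · simp at h
  · exact hD h'

theorem tendsto_integral_map_of_norm_le (ρ : Measure ℝ) [IsFiniteMeasure ρ] {f : ℕ → ℝ → ℝ}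
    (hf : ∀ n, Measurable (f n)) {φ : ℕ → ℝ → ℂ} (hφ : ∀ n, Measurable (φ n)) {ψ : ℝ → ℂ} {C : ℝ}
    (hC : ∀ᶠ n in atTop, ∀ t, ‖φ n t‖ ≤ C)
    (hlim : ∀ᵐ t ∂ρ, Tendsto (fun n => φ n (f n t)) atTop (𝓝 (ψ t))) :
    Tendsto (fun n => ∫ t, φ n t ∂(ρ.map (f n))) atTop (𝓝 (∫ t, ψ t ∂ρ)) := by
  simp only [fun n => integral_map (hf n).aemeasurable (μ := ρ)
    (hφ n).stronglyMeasurable.aestronglyMeasurable]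
  refine tendsto_integral_filter_of_dominated_convergence (fun _ => C)
    (.of_forall fun n => ((hφ n).comp (hf n)).stronglyMeasurable.aestronglyMeasurable)
    (hC.mono fun n hn => .of_forall fun t => hn _) (integrable_const C) hlim

theorem tendsto_altConvTransform_map (μ ν : Measure ℝ) [IsProbabilityMeasure μ]
    [IsProbabilityMeasure ν] {f g : ℕ → ℝ → ℝ} (hf : ∀ n, Measurable (f n))
    (hg : ∀ n, Measurable (g n)) (hfν : ∀ᵐ t ∂ν, Tendsto (fun n => f n t) atTop (𝓝 t))
    (hgμ : ∀ᵐ x ∂μ, Tendsto (fun n => g n x) atTop (𝓝 x)) {z : ℂ} (hz : z.im ≠ 0)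
    (hD : (z * cauchyTransform ν z - 1).im ≠ 0) :
    Tendsto (fun n => altConvTransform (μ.map (g n)) (ν.map (f n)) z) atTop
      (𝓝 (altConvTransform μ ν z)) := by
  have hne : ∀ t : ℝ, z - t ≠ 0 := fun t h => hz (by simpa using congrArg Complex.im h)
  have hG : Tendsto (fun n => cauchyTransform (ν.map (f n)) z) atTop (𝓝 (cauchyTransform ν z)) := by
    refine tendsto_integral_map_of_norm_le ν hf (fun _ => by fun_prop)
      (.of_forall fun _ t => norm_inv_sub_le hz t) ?_
    filter_upwards [hfν] with t ht
    exact (tendsto_const_nhds.sub ht.ofReal).inv₀ (hne t)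
  have hW : Tendsto (fun n => sqrtCauchyTransform (ν.map (f n)) z) atTop
      (𝓝 (sqrtCauchyTransform ν z)) := by
    refine tendsto_integral_map_of_norm_le ν hf (fun _ => by fun_prop)
      (.of_forall fun _ t => norm_sqrt_div_sub_le hz t) ?_
    filter_upwards [hfν] with t ht
    exact ht.sqrt.ofReal.div (tendsto_const_nhds.sub ht.ofReal) (hne t)
  have hDlim := (hG.const_mul z).sub_const 1
  refine hG.sub ((hW.pow 2).mul ?_)
  have hbd : ∀ᶠ n in atTop,
      |(z * cauchyTransform ν z - 1).im| / 2 < |(z * cauchyTransform (ν.map (f n)) z - 1).im| :=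
    ((Complex.continuous_im.tendsto _).comp hDlim).abs.eventually_const_lt
      (half_lt_self (abs_pos.2 hD))
  refine tendsto_integral_map_of_norm_le μ hg (fun _ => by fun_prop)
    (C := (|(z * cauchyTransform ν z - 1).im| / 2)⁻¹) ?_ ?_
  · filter_upwards [hbd] with n hn x
    have h0 : 0 < |(z * cauchyTransform ν z - 1).im| / 2 := half_pos (abs_pos.2 hD)
    have := norm_div_one_add_mul_le (abs_pos.1 (h0.trans hn)) (1 - x)
    push_cast at this
    exact this.trans (inv_anti₀ h0 hn.le)
  · filter_upwards [hgμ] with x hx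
    have hx' := (tendsto_const_nhds (x := (1 : ℂ))).sub hx.ofReal
    refine hx'.div (tendsto_const_nhds.add (hx'.mul hDlim)) ?_
    have := one_add_mul_ne_zero hD (1 - x)
    push_cast at this
    exact this

theorem im_mul_norm_sq_sqrtCauchyTransform_le {ρ : Measure ℝ} [IsProbabilityMeasure ρ]
    (hρ : ρ (Set.Iio 0) = 0) {z : ℂ} (hz : 0 < z.im) :
    z.im * ‖sqrtCauchyTransform ρ z‖ ^ 2 ≤ |(z * cauchyTransform ρ z - 1).im| := by
  have hX : MemLp (fun t : ℝ => ‖(√t : ℂ) / (z - t)‖) 2 ρ :=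
    MemLp.of_bound (by fun_prop : Measurable _).aestronglyMeasurable _
      (.of_forall fun t => by simpa using norm_sqrt_div_sub_le hz.ne' t)
  have hsq : (∫ t : ℝ, ‖(√t : ℂ) / (z - t)‖ ∂ρ) ^ 2 ≤ ∫ t : ℝ, ‖(√t : ℂ) / (z - t)‖ ^ 2 ∂ρ := by
    have h := variance_nonneg (fun t : ℝ => ‖(√t : ℂ) / (z - t)‖) ρ
    rw [variance_eq_sub hX] at h
    simpa using h
  have him : (z * cauchyTransform ρ z - 1).im
      = -(z.im * ∫ t : ℝ, ‖(√t : ℂ) / (z - t)‖ ^ 2 ∂ρ) := by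
    rw [mul_cauchyTransform_sub_one ρ hz.ne', ← integral_const_mul, ← integral_neg]
    refine (integral_im (integrable_div_sub ρ hz.ne')).symm.trans (integral_congr_ae ?_)
    filter_upwards [ae_nonneg_of_measure_Iio_zero hρ] with t ht
    have : ‖(√t : ℂ) / (z - t)‖ ^ 2 = t / Complex.normSq (z - t) := by
      rw [norm_div, div_pow, Complex.norm_real, Real.norm_eq_abs, sq_abs, Real.sq_sqrt ht,
        Complex.normSq_eq_norm_sq]
    rw [this]
    exact im_div_sub z t
  rw [him, abs_neg]
  refine le_trans ?_ (le_abs_self _)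
  gcongr
  refine le_trans ?_ hsq
  gcongr
  exact norm_integral_le_integral_norm _

theorem tendsto_mul_cauchyTransform_sub_one (ρ : Measure ℝ) [IsProbabilityMeasure ρ] :
    Tendsto (fun y : ℝ => y * Complex.I * cauchyTransform ρ (y * Complex.I) - 1) atTop (𝓝 0) := by
  have hlim : Tendsto (fun y : ℝ => ∫ t : ℝ, t / (y * Complex.I - t) ∂ρ) atTop
      (𝓝 (∫ _ : ℝ, 0 ∂ρ)) := by
    refine tendsto_integral_filter_of_dominated_convergence (fun _ => 1)
      (.of_forall fun y => (by fun_prop : Measurable _).aestronglyMeasurable)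
      (.of_forall fun y => .of_forall fun t => ?_)
      (integrable_const 1) (.of_forall fun t => ?_)
    · rw [norm_div]
      refine div_le_one_of_le₀ ?_ (norm_nonneg _)
      simpa using Complex.abs_re_le_norm (y * Complex.I - t)
    · refine squeeze_zero_norm' (a := fun y : ℝ => |t| * |y|⁻¹) ?_ ?_
      · filter_upwards [eventually_ne_atTop 0] with y hy
        have := norm_inv_sub_le (z := y * Complex.I) (by simpa using hy) t
        rw [div_eq_mul_inv, norm_mul, Complex.norm_real, Real.norm_eq_abs]
        gcongr
        simpa using this
      · simpa using (tendsto_inv_atTop_zero.comp tendsto_abs_atTop_atTop).const_mul |t|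
  rw [integral_zero] at hlim
  refine hlim.congr' ?_
  filter_upwards [eventually_ne_atTop 0] with y hy
  exact (mul_cauchyTransform_sub_one ρ (by simpa using hy)).symm

theorem tendsto_mul_altConvTransform (μ : Measure ℝ) {ν : Measure ℝ} [IsProbabilityMeasure μ]
    [IsProbabilityMeasure ν] (hν : ν (Set.Iio 0) = 0) (hν0 : ν ≠ Measure.dirac 0) :
    Tendsto (fun y : ℝ => y * Complex.I * altConvTransform μ ν (y * Complex.I)) atTop (𝓝 1) := by
  set D : ℝ → ℂ := fun y => y * Complex.I * cauchyTransform ν (y * Complex.I) - 1 with hDdef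
  set W : ℝ → ℂ := fun y => sqrtCauchyTransform ν (y * Complex.I)
  have hD : Tendsto D atTop (𝓝 0) := tendsto_mul_cauchyTransform_sub_one ν
  have hle : ∀ y : ℝ, 0 < y → ‖(y * Complex.I * W y ^ 2 : ℂ)‖ ≤ |(D y).im| := by
    intro y hy
    have := im_mul_norm_sq_sqrtCauchyTransform_le hν (z := y * Complex.I) (by simpa using hy)
    have him : (y * Complex.I).im = y := by simp
    rw [him] at this
    refine le_of_eq_of_le ?_ this
    simp [W, abs_of_pos hy]
  have hlim : Tendsto (fun y : ℝ => ∫ x : ℝ,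
      y * Complex.I * W y ^ 2 * (((1 - x : ℝ) : ℂ) / (1 + ((1 - x : ℝ) : ℂ) * D y)) ∂μ) atTop
      (𝓝 (∫ _ : ℝ, 0 ∂μ)) := by
    refine tendsto_integral_filter_of_dominated_convergence (fun _ => 1)
      (.of_forall fun y => (by fun_prop : Measurable _).aestronglyMeasurable) ?_
      (integrable_const 1) (.of_forall fun x => ?_)
    · filter_upwards [eventually_gt_atTop 0] with y hy
      refine .of_forall fun x => ?_
      have hDim : (D y).im ≠ 0 :=
        (im_mul_cauchyTransform_sub_one_neg hν hν0 (by simpa using hy)).ne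
      rw [norm_mul]
      refine (mul_le_mul (hle y hy) (norm_div_one_add_mul_le hDim _) (norm_nonneg _)
        (abs_nonneg _)).trans_eq (mul_inv_cancel₀ (abs_ne_zero.2 hDim))
    · refine squeeze_zero_norm' (a := fun y : ℝ =>
        ‖D y‖ * ‖((1 - x : ℝ) : ℂ) / (1 + ((1 - x : ℝ) : ℂ) * D y)‖) ?_ ?_
      · filter_upwards [eventually_gt_atTop 0] with y hy
        rw [norm_mul]
        gcongr
        exact (hle y hy).trans (Complex.abs_im_le_norm _)
      · have h1 : Tendsto (fun y => ((1 - x : ℝ) : ℂ) / (1 + ((1 - x : ℝ) : ℂ) * D y)) atTop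
            (𝓝 (((1 - x : ℝ) : ℂ) / (1 + ((1 - x : ℝ) : ℂ) * 0))) :=
          tendsto_const_nhds.div (tendsto_const_nhds.add (hD.const_mul _)) (by simp)
        simpa using hD.norm.mul h1.norm
  rw [integral_zero] at hlim
  have := (hD.add_const 1).sub hlim
  rw [zero_add, sub_zero] at this
  refine this.congr fun y => ?_
  simp only [integral_const_mul, altConvTransform, hDdef, W, Complex.ofReal_sub,
    Complex.ofReal_one]
  ring

/-- A pointwise limit of Cauchy transforms of probability measures on `[0,∞)` which is `1 / z` to
first order along the imaginary axis is again such a Cauchy transform. -/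
theorem exists_measure_of_tendsto_cauchyTransform {l : ℕ → Measure ℝ}
    (hl : ∀ n, IsProbabilityMeasure (l n)) (hl0 : ∀ n, l n (Set.Iio 0) = 0) {F : ℂ → ℂ}
    (hF : ∀ z : ℂ, 0 < z.im → Tendsto (fun n => cauchyTransform (l n) z) atTop (𝓝 (F z)))
    (hF1 : Tendsto (fun y : ℝ => y * Complex.I * F (y * Complex.I)) atTop (𝓝 1)) :
    ∃ m : Measure ℝ, IsProbabilityMeasure m ∧ m (Set.Iio 0) = 0 ∧
      ∀ z : ℂ, 0 < z.im → cauchyTransform m z = F z := by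
  set p : ℝ → unitInterval := fun s => Set.projIcc 0 1 zero_le_one (1 + s)⁻¹
  have hp : Measurable p := continuous_projIcc.measurable.comp (by fun_prop)
  have hp_coe : ∀ s : ℝ, 0 ≤ s → (p s : ℝ) = (1 + s)⁻¹ := fun s hs => by
    have : (1 + s)⁻¹ ∈ Set.Icc (0 : ℝ) 1 := ⟨by positivity, inv_le_one_of_one_le₀ (by linarith)⟩
    simp only [p, Set.projIcc_of_mem _ this]
  set k : ℂ → unitInterval → ℂ := fun z u => (u : ℝ) / (z * (u : ℝ) + (u : ℝ) - 1)
  have hden : ∀ z : ℂ, 0 < z.im → ∀ u : unitInterval, z * (u : ℝ) + (u : ℝ) - 1 ≠ 0 := by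
    intro z hz u h
    have h1 : z.im * (u : ℝ) = 0 := by simpa using congrArg Complex.im h
    have h2 : (u : ℝ) = 0 := by simpa [hz.ne'] using h1
    simp [h2] at h
  have hkc : ∀ z : ℂ, 0 < z.im → Continuous (k z) := fun z hz =>
    Continuous.div (by fun_prop) (by fun_prop) (hden z hz)
  have hkp : ∀ z : ℂ, 0 < z.im → ∀ s : ℝ, 0 ≤ s → k z (p s) = (z - s)⁻¹ := by
    intro z hz s hs
    have h1 : (1 + s : ℂ) ≠ 0 := by exact_mod_cast (by positivity : (1 + s : ℝ) ≠ 0)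
    simp only [k, hp_coe s hs]
    push_cast
    rw [← inv_inv (_ / _), inv_div]
    congr 1
    field_simp
    ring
  let P : ℕ → ProbabilityMeasure unitInterval := fun n =>
    ⟨(l n).map p, Measure.isProbabilityMeasure_map hp.aemeasurable⟩
  obtain ⟨σ, -, hσ⟩ := (isCompact_univ (X := ProbabilityMeasure unitInterval)).ultrafilter_le_nhds
    ((hyperfilter ℕ).map P) (by simp)
  have hint : ∀ z : ℂ, 0 < z.im → ∫ u, k z u ∂(σ : Measure unitInterval) = F z := by
    intro z hz
    have h1 := (ProbabilityMeasure.tendsto_iff_forall_integral_rclike_tendsto ℂ).1 hσ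
      (BoundedContinuousFunction.mkOfCompact ⟨k z, hkc z hz⟩)
    have h2 := (hF z hz).mono_left Nat.hyperfilter_le_atTop
    refine tendsto_nhds_unique h1 (h2.congr fun n => ?_)
    simp only [P, ProbabilityMeasure.coe_mk, BoundedContinuousFunction.mkOfCompact_apply,
      ContinuousMap.coe_mk]
    rw [integral_map hp.aemeasurable (hkc z hz).aestronglyMeasurable]
    refine integral_congr_ae ?_
    filter_upwards [ae_nonneg_of_measure_Iio_zero (hl0 n)] with s hs
    exact (hkp z hz s hs).symm
  have hσ0 : ∀ᵐ u ∂(σ : Measure unitInterval), u ≠ 0 := by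
    have hlim : Tendsto (fun y : ℝ => ∫ u, y * Complex.I * k (y * Complex.I) u
        ∂(σ : Measure unitInterval)) atTop
        (𝓝 (∫ u, Set.indicator {0}ᶜ 1 u ∂(σ : Measure unitInterval))) := by
      refine tendsto_integral_filter_of_dominated_convergence (fun _ => 1)
        (.of_forall fun y => (by fun_prop : Measurable _).aestronglyMeasurable)
        (.of_forall fun y => .of_forall fun u => ?_) (integrable_const 1) (.of_forall fun u => ?_)
      · rw [mul_div, norm_div]
        refine div_le_one_of_le₀ ?_ (norm_nonneg _)
        simpa using Complex.abs_im_le_norm (y * Complex.I * (u : ℝ) + (u : ℝ) - 1)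
      · rcases eq_or_ne u 0 with rfl | hu
        · simp [k]
        have hu' : ((u : ℝ) : ℂ) ≠ 0 := by simpa using hu
        have hinv : Tendsto (fun y : ℝ => (y : ℂ)⁻¹) atTop (𝓝 0) := by
          simpa using (tendsto_inv_atTop_zero (𝕜 := ℝ)).ofReal
        have h1 : Tendsto (fun y : ℝ => Complex.I * (u : ℝ) /
            (Complex.I * (u : ℝ) + ((u : ℝ) - 1) * (y : ℂ)⁻¹)) atTop
            (𝓝 (Complex.I * (u : ℝ) / (Complex.I * (u : ℝ) + ((u : ℝ) - 1) * 0))) :=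
          tendsto_const_nhds.div (tendsto_const_nhds.add (hinv.const_mul _)) (by simpa using hu')
        rw [mul_zero, add_zero, div_self (by simpa using hu')] at h1
        simp only [Set.indicator_of_mem (Set.mem_compl_singleton_iff.2 hu), Pi.one_apply]
        refine h1.congr' ?_
        filter_upwards [eventually_ne_atTop 0] with y hy
        have hy' : (y : ℂ) ≠ 0 := by exact_mod_cast hy
        rw [← mul_div_mul_left _ _ hy']
        simp only [k]
        field_simp
        ring
    have h1 : ∫ u, Set.indicator {0}ᶜ (1 : unitInterval → ℂ) u ∂(σ : Measure unitInterval) = 1 := by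
      refine tendsto_nhds_unique hlim (hF1.congr' ?_)
      filter_upwards [eventually_gt_atTop 0] with y hy
      rw [integral_const_mul, hint _ (by simpa using hy)]
    rw [integral_indicator (measurableSet_singleton 0).compl] at h1
    have h2 : (σ : Measure unitInterval).real {0}ᶜ = 1 := by
      simpa only [Pi.one_apply, setIntegral_const, Complex.real_smul, mul_one,
        Complex.ofReal_eq_one] using h1
    rw [ae_iff]
    simpa using (prob_compl_eq_one_iff (measurableSet_singleton 0)).1
      ((ENNReal.toReal_eq_one_iff _).1 h2)
  set q : unitInterval → ℝ := fun u => (u : ℝ)⁻¹ - 1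
  have hq : Measurable q := by fun_prop
  refine ⟨(σ : Measure unitInterval).map q, Measure.isProbabilityMeasure_map hq.aemeasurable, ?_,
    fun z hz => ?_⟩
  · rw [Measure.map_apply hq measurableSet_Iio]
    refine measure_mono_null (fun u hu => ?_) (ae_iff.1 hσ0)
    simp only [Set.mem_preimage, Set.mem_Iio, q, sub_neg] at hu
    simp only [Set.mem_ofPred_eq, not_not]
    by_contra hne
    exact hu.not_ge ((one_le_inv₀ (unitInterval.pos_iff_ne_zero.2 hne)).2 u.2.2)
  · rw [cauchyTransform, integral_map hq.aemeasurable (by fun_prop), ← hint z hz]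
    refine integral_congr_ae ?_
    filter_upwards [hσ0] with u hu
    have hu' : ((u : ℝ) : ℂ) ≠ 0 := by simpa using hu
    have h2 := hden z hz u
    simp only [k, q]
    push_cast
    rw [← inv_inv (_ / _), inv_div]
    congr 1
    field_simp
    ring

theorem altConvTransform_eq (μ ν : Measure ℝ) [IsProbabilityMeasure μ] {z : ℂ}
    (hD : (z * cauchyTransform ν z - 1).im ≠ 0) :
    altConvTransform μ ν z = cauchyTransform ν z
      - (sqrtCauchyTransform ν z) ^ 2 / (z * cauchyTransform ν z - 1)
      + (sqrtCauchyTransform ν z) ^ 2 / (z * cauchyTransform ν z - 1) ^ 2 *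
          cauchyTransform μ (z * cauchyTransform ν z / (z * cauchyTransform ν z - 1)) := by
  rw [altConvTransform]
  set D := z * cauchyTransform ν z - 1 with hDdef
  have hzG : z * cauchyTransform ν z = D + 1 := by rw [hDdef]; ring
  have hD0 : D ≠ 0 := fun h => hD (by simp [h])
  rw [hzG]
  have hw : ((D + 1) / D).im ≠ 0 := by
    rw [add_div, div_self hD0, one_div, Complex.add_im, Complex.inv_im]
    simpa [hD0] using hD
  have hker : ∀ x : ℝ, ((1 - x) / (1 + (1 - x) * D) : ℂ)
      = 1 / D - 1 / D ^ 2 * ((D + 1) / D - x)⁻¹ := by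
    intro x
    have h1 := one_add_mul_ne_zero hD (1 - x)
    push_cast at h1
    have h2 : (D + 1) / D - x = (1 + (1 - x) * D) / D := by field_simp; ring
    rw [h2]
    field_simp
    ring
  simp only [hker]
  rw [integral_sub (integrable_const _) ((integrable_inv_sub μ hw).const_mul _), integral_const_mul,
    ← cauchyTransform, integral_const]
  simp only [probReal_univ, one_smul]
  ring

/-- Existence and uniqueness of the alternative multiplicative monotone convolution
`μ ▷̃ ν`: the unique probability measure on `[0,∞)` with Cauchy transform
`G_ν(z) − W_ν(z)²/(zG_ν(z)−1) + [W_ν(z)²/(zG_ν(z)−1)²]·G_μ(zG_ν(z)/(zG_ν(z)−1))`. -/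
theorem monotone_mult_alt_convolution_exists_unique
    (μ ν : Measure ℝ) [IsProbabilityMeasure μ] [IsProbabilityMeasure ν]
    (hμ : μ (Set.Iio 0) = 0) (hν : ν (Set.Iio 0) = 0) (hν0 : ν ≠ Measure.dirac 0) :
    ∃! l : Measure ℝ, IsProbabilityMeasure l ∧ l (Set.Iio 0) = 0 ∧
      ∀ z : ℂ, 0 < z.im →
        cauchyTransform l z
          = cauchyTransform ν z
            - (sqrtCauchyTransform ν z) ^ 2 / (z * cauchyTransform ν z - 1)
            + (sqrtCauchyTransform ν z) ^ 2 / (z * cauchyTransform ν z - 1) ^ 2 *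
                cauchyTransform μ
                  (z * cauchyTransform ν z / (z * cauchyTransform ν z - 1)) := by
  have hD : ∀ z : ℂ, 0 < z.im → (z * cauchyTransform ν z - 1).im ≠ 0 := fun z hz =>
    (im_mul_cauchyTransform_sub_one_neg hν hν0 hz).ne
  set f : ℕ → SimpleFunc ℝ ℝ :=
    SimpleFunc.approxOn id measurable_id (Set.Ici 0) 0 Set.self_mem_Ici
  have hf : ∀ n x, 0 ≤ f n x := fun n x => SimpleFunc.approxOn_mem measurable_id _ n x
  have hlim : ∀ ρ : Measure ℝ, ρ (Set.Iio 0) = 0 →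
      ∀ᵐ t ∂ρ, Tendsto (fun n => f n t) atTop (𝓝 t) := fun ρ hρ => by
    filter_upwards [ae_nonneg_of_measure_Iio_zero hρ] with t ht
    exact SimpleFunc.tendsto_approxOn measurable_id _ (subset_closure ht)
  choose l hl hl0 hlG using fun n => exists_measure_of_simpleFunc μ ν (hf n) (hf n)
  obtain ⟨m, hm, hm0, hmG⟩ := exists_measure_of_tendsto_cauchyTransform hl hl0
    (F := altConvTransform μ ν) (fun z hz => by
      simp only [hlG _ z hz]
      exact tendsto_altConvTransform_map μ ν (fun n => (f n).measurable)
        (fun n => (f n).measurable) (hlim ν hν) (hlim μ hμ) hz.ne' (hD z hz))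
    (tendsto_mul_altConvTransform μ hν hν0)
  refine ⟨m, ⟨hm, hm0, fun z hz => ?_⟩, ?_⟩
  · rw [hmG z hz, altConvTransform_eq μ ν (hD z hz)]
  · rintro m' ⟨hm', -, hm'G⟩
    refine eq_of_cauchyTransform_eq fun z hz => ?_
    rw [hmG z hz, hm'G z hz, altConvTransform_eq μ ν (hD z hz)]
end
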